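/- arXiv:1909.08425 — 11 statements merged into one kernel-verified Lean document; each statement's English description precedes it below -/
import Mathlib

section
/- Let m : ℕ → ℕ be a sequence of nonnegative integers. The direct limit G(m) is the trivial group if and only if m j = 0 for infinitely many indices j. -/
/-- The bonding homomorphism of the direct system `ℤ → ℤ → ⋯` whose `j`-th arrow is
multiplication by `m j`: the map from stage `i` to stage `j` is multiplication by
`∏_{t ∈ [i, j)} m t`. -/
def bondMap (m : ℕ → ℕ) (i j : ℕ) (_ : i ≤ j) : ℤ →+ ℤ :=
  AddMonoidHom.mulLeft (∏ t ∈ Finset.Ico i j, (m t : ℤ))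

instance bondMap_directedSystem (m : ℕ → ℕ) :
    DirectedSystem (fun _ : ℕ => ℤ) (fun i j h => bondMap m i j h) where
  map_self := by
    intro i x
    simp [bondMap]
  map_map := by
    intro k j i hij hjk x
    show (∏ t ∈ Finset.Ico j k, (m t : ℤ)) * ((∏ t ∈ Finset.Ico i j, (m t : ℤ)) * x) =
      (∏ t ∈ Finset.Ico i k, (m t : ℤ)) * x
    rw [← mul_assoc, mul_comm (∏ t ∈ Finset.Ico j k, (m t : ℤ)) (∏ t ∈ Finset.Ico i j, (m t : ℤ)),
      Finset.prod_Ico_consecutive _ hij hjk]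

/-- `DirLimZ m` is the direct limit of the direct system of additive abelian groups
`ℤ → ℤ → ℤ → ⋯` indexed by `ℕ` in which the `j`-th bonding map is multiplication by `m j`. -/
noncomputable abbrev DirLimZ (m : ℕ → ℕ) : Type :=
  AddCommGroup.DirectLimit (fun _ : ℕ => ℤ) (bondMap m)

/-- A nonzero integer at stage `i` vanishes in the direct limit if and only if one of the bonding
maps from stage `i` on is zero. -/
theorem DirLimZ.of_eq_zero_iff (m : ℕ → ℕ) (i : ℕ) {x : ℤ} (hx : x ≠ 0) :
    AddCommGroup.DirectLimit.of (fun _ : ℕ => ℤ) (bondMap m) i x = 0 ↔ ∃ j ≥ i, m j = 0 := by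
  constructor
  · intro h
    obtain ⟨k, hik, hk⟩ := AddCommGroup.DirectLimit.of.zero_exact
      (G := fun _ : ℕ => ℤ) (f := bondMap m) i x h
    have hprod : ∏ t ∈ Finset.Ico i k, (m t : ℤ) = 0 := (mul_eq_zero.mp hk).resolve_right hx
    obtain ⟨j, hj, hmj⟩ := Finset.prod_eq_zero_iff.mp hprod
    exact ⟨j, (Finset.mem_Ico.mp hj).1, by exact_mod_cast hmj⟩
  · rintro ⟨j, hij, hmj⟩
    have hij' : i ≤ j + 1 := by lia
    have hprod : ∏ t ∈ Finset.Ico i (j + 1), (m t : ℤ) = 0 :=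
      Finset.prod_eq_zero (Finset.mem_Ico.mpr ⟨hij, j.lt_succ_self⟩) (by simp [hmj])
    rw [← AddCommGroup.DirectLimit.of_f hij']
    simp [bondMap, hprod]

/-- The direct limit `G(m)` is the trivial group if and only if `m j = 0` for
infinitely many indices `j`. -/
theorem directLimit_trivial_iff (m : ℕ → ℕ) :
    Subsingleton (DirLimZ m) ↔ {j : ℕ | m j = 0}.Infinite := by
  rw [← Nat.frequently_atTop_iff_infinite, Filter.frequently_atTop]
  constructor
  · intro h i
    exact (DirLimZ.of_eq_zero_iff m i one_ne_zero).mp (Subsingleton.elim _ _)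
  · intro h
    refine subsingleton_of_forall_eq 0 fun z => ?_
    induction z using AddCommGroup.DirectLimit.induction_on with
    | ih i x =>
      rcases eq_or_ne x 0 with rfl | hx
      · exact map_zero _
      · exact (DirLimZ.of_eq_zero_iff m i hx).mpr (h i)
end

section
/- Let m : ℕ → ℕ be a sequence of nonnegative integers. The direct limit G(m) is isomorphic to ℤ (as an additive abelian group) if and only if there exists N such that m j = 1 for all j ≥ N. -/
theorem bondMap_apply (m : ℕ → ℕ) {i j : ℕ} (h : i ≤ j) (x : ℤ) :
    bondMap m i j h x = (∏ t ∈ Finset.Ico i j, (m t : ℤ)) * x :=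
  rfl

theorem bondMap_eq_self {m : ℕ → ℕ} {N : ℕ} (hm : ∀ j, N ≤ j → m j = 1) {j : ℕ} (h : N ≤ j)
    (x : ℤ) : bondMap m N j h x = x := by
  rw [bondMap_apply, Finset.prod_eq_one, one_mul]
  intro t ht
  rw [hm t (Finset.mem_Ico.1 ht).1, Nat.cast_one]

theorem of_bondMap (m : ℕ → ℕ) {i j : ℕ} (h : i ≤ j) (x : ℤ) :
    AddCommGroup.DirectLimit.of (fun _ : ℕ => ℤ) (bondMap m) j (bondMap m i j h x) =
      AddCommGroup.DirectLimit.of (fun _ : ℕ => ℤ) (bondMap m) i x :=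
  AddCommGroup.DirectLimit.of_f (G := fun _ : ℕ => ℤ) h x

theorem bijective_of_of_forall_ge_eq_one {m : ℕ → ℕ} {N : ℕ} (hm : ∀ j, N ≤ j → m j = 1) :
    Function.Bijective (AddCommGroup.DirectLimit.of (fun _ : ℕ => ℤ) (bondMap m) N) := by
  constructor
  · rw [injective_iff_map_eq_zero]
    intro x hx
    obtain ⟨j, hj, h⟩ := AddCommGroup.DirectLimit.of.zero_exact (G := fun _ : ℕ => ℤ) N x hx
    rwa [bondMap_eq_self hm hj] at h
  · intro z
    induction z using AddCommGroup.DirectLimit.induction_on with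
    | ih i x =>
      refine ⟨bondMap m i (max i N) (le_max_left i N) x, ?_⟩
      rw [← of_bondMap m (le_max_left i N) x, ← of_bondMap m (le_max_right i N),
        bondMap_eq_self hm (le_max_right i N)]

theorem exists_forall_ge_eq_one_of_surjective {m : ℕ → ℕ} (f : DirLimZ m →+ ℤ)
    (hf : Function.Surjective f) : ∃ N : ℕ, ∀ j : ℕ, N ≤ j → m j = 1 := by
  let a (j : ℕ) : ℤ := f (AddCommGroup.DirectLimit.of (fun _ : ℕ => ℤ) (bondMap m) j 1)
  have ha (j : ℕ) (x : ℤ) :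
      f (AddCommGroup.DirectLimit.of (fun _ : ℕ => ℤ) (bondMap m) j x) = x * a j := by
    simpa using map_zsmul
      (f.comp (AddCommGroup.DirectLimit.of (fun _ : ℕ => ℤ) (bondMap m) j)) x (1 : ℤ)
  have ha_succ (j : ℕ) : a j = m j * a (j + 1) := by
    simp only [a]
    rw [← of_bondMap m (Nat.le_succ j), ha]
    simp [bondMap_apply, a]
  obtain ⟨z, hz⟩ := hf 1
  induction z using AddCommGroup.DirectLimit.induction_on with
  | ih N x =>
    have hunit (j : ℕ) (hj : N ≤ j) : IsUnit (a j) := by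
      induction j, hj using Nat.le_induction with
      | base => exact .of_mul_eq_one_right x (by rw [← ha, hz])
      | succ j _ ih =>
        rw [ha_succ] at ih
        exact isUnit_of_mul_isUnit_right ih
    refine ⟨N, fun j hj => ?_⟩
    have h := hunit j hj
    rw [ha_succ] at h
    exact Nat.isUnit_iff.1 (Int.ofNat_isUnit.1 (isUnit_of_mul_isUnit_left h))

/-- The direct limit `G(m)` is isomorphic to `ℤ` (as an additive abelian group) if and
only if there exists `N` such that `m j = 1` for all `j ≥ N`. -/
theorem directLimit_int_iff (m : ℕ → ℕ) :
    Nonempty (DirLimZ m ≃+ ℤ) ↔ ∃ N : ℕ, ∀ j : ℕ, N ≤ j → m j = 1 := by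
  constructor
  · rintro ⟨e⟩
    exact exists_forall_ge_eq_one_of_surjective e.toAddMonoidHom e.surjective
  · rintro ⟨N, hm⟩
    exact ⟨(AddEquiv.ofBijective _ (bijective_of_of_forall_ge_eq_one hm)).symm⟩
end

section
/- Let m : ℕ → ℕ be a sequence of nonnegative integers such that m j = 0 for only finitely many indices j and m j ≥ 2 for infinitely many indices j. Then the direct limit G(m) is not finitely generated as an abelian group (equivalently, not finitely generated as a ℤ-module). -/
theorem DirLimZ.range_of_mono (m : ℕ → ℕ) :
    Monotone fun n => (AddCommGroup.DirectLimit.of (fun _ : ℕ => ℤ) (bondMap m) n).range := by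
  rintro i j hij _ ⟨x, rfl⟩
  exact ⟨bondMap m i j hij x, AddCommGroup.DirectLimit.of_f (G := fun _ : ℕ => ℤ) (f := bondMap m) hij x⟩

theorem DirLimZ.exists_range_of_eq_top (m : ℕ → ℕ) (h : AddGroup.FG (DirLimZ m)) (N : ℕ) :
    ∃ n, N ≤ n ∧ (AddCommGroup.DirectLimit.of (fun _ : ℕ => ℤ) (bondMap m) n).range = ⊤ := by
  obtain ⟨S, hS⟩ := h.out
  have hmem (z : DirLimZ m) :
      ∃ n, z ∈ (AddCommGroup.DirectLimit.of (fun _ : ℕ => ℤ) (bondMap m) n).range :=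
    AddCommGroup.DirectLimit.induction_on z fun i x => ⟨i, x, rfl⟩
  choose f hf using hmem
  refine ⟨max N (S.sup f), le_max_left _ _, ?_⟩
  rw [eq_top_iff, ← hS, AddSubgroup.closure_le]
  intro s hs
  exact DirLimZ.range_of_mono m ((Finset.le_sup hs).trans (le_max_right _ _)) (hf s)

/-- If `m j = 0` for only finitely many indices `j` and `m j ≥ 2` for infinitely many
indices `j`, then the direct limit `G(m)` is not finitely generated as an abelian group. -/
theorem directLimit_not_fg (m : ℕ → ℕ)
    (h0 : {j : ℕ | m j = 0}.Finite) (h2 : {j : ℕ | 2 ≤ m j}.Infinite) :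
    ¬ AddGroup.FG (DirLimZ m) := by
  intro h
  obtain ⟨B, hB⟩ := h0.bddAbove
  obtain ⟨n, hBn, hn⟩ := DirLimZ.exists_range_of_eq_top m h (B + 1)
  obtain ⟨j, hj, hnj⟩ := h2.exists_gt n
  have hle : n ≤ j + 1 := by omega
  obtain ⟨a, ha⟩ : AddCommGroup.DirectLimit.of (fun _ : ℕ => ℤ) (bondMap m) (j + 1) 1 ∈
      (AddCommGroup.DirectLimit.of (fun _ : ℕ => ℤ) (bondMap m) n).range := hn ▸ AddSubgroup.mem_top _
  rw [← AddCommGroup.DirectLimit.of_f hle, ← sub_eq_zero, ← map_sub] at ha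
  obtain ⟨k, hk, hzero⟩ :=
    AddCommGroup.DirectLimit.of.zero_exact (G := fun _ : ℕ => ℤ) (f := bondMap m) _ _ ha
  have hprod : ∏ t ∈ Finset.Ico (j + 1) k, (m t : ℤ) ≠ 0 := by
    refine Finset.prod_ne_zero_iff.2 fun t ht h0t => ?_
    have htB : t ≤ B := hB (Nat.cast_eq_zero.1 h0t)
    have := (Finset.mem_Ico.1 ht).1
    omega
  have hone : (∏ t ∈ Finset.Ico n (j + 1), (m t : ℤ)) * a = 1 :=
    sub_eq_zero.1 ((mul_eq_zero.1 hzero).resolve_left hprod)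
  have hdvd : (m j : ℤ) ∣ ∏ t ∈ Finset.Ico n (j + 1), (m t : ℤ) :=
    Finset.dvd_prod_of_mem (fun t => (m t : ℤ)) (Finset.mem_Ico.2 ⟨hnj.le, j.lt_succ_self⟩)
  have hm : m j ∣ 1 := by exact_mod_cast hone ▸ hdvd.mul_right a
  have : 2 ≤ m j := hj
  have := Nat.dvd_one.1 hm
  omega
end

section
/- Let m : ℕ → ℕ be a sequence of nonnegative integers and let p be a prime number. Then p divides the direct limit G(m) (i.e. every element of G(m) is divisible by p) if and only if p divides m j for infinitely many indices j. -/
/-- A prime `p` divides the direct limit `G(m)` (i.e. every element of `G(m)` is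
divisible by `p`) if and only if `p` divides `m j` for infinitely many indices `j`. -/
theorem prime_divides_directLimit_iff (m : ℕ → ℕ) (p : ℕ) (hp : p.Prime) :
    (∀ g : DirLimZ m, ∃ g' : DirLimZ m, p • g' = g) ↔ {j : ℕ | p ∣ m j}.Infinite := by
  constructor
  · intro hdiv
    by_contra hfin
    obtain ⟨b, hb⟩ := (Set.not_infinite.mp hfin).bddAbove
    obtain ⟨g', hg'⟩ := hdiv (AddCommGroup.DirectLimit.of _ (bondMap m) (b + 1) 1)
    induction g' using AddCommGroup.DirectLimit.induction_on with
    | ih i x =>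
      have hi : i ≤ max i (b + 1) := le_max_left _ _
      have hN : b + 1 ≤ max i (b + 1) := le_max_right _ _
      generalize max i (b + 1) = k at hi hN
      rw [← AddCommGroup.DirectLimit.of_f hi, ← AddCommGroup.DirectLimit.of_f hN,
        ← map_nsmul, ← sub_eq_zero, ← map_sub] at hg'
      obtain ⟨j, hkj, hj⟩ := AddCommGroup.DirectLimit.of.zero_exact _ _ hg'
      simp only [bondMap_apply, nsmul_eq_mul, mul_one, mul_sub, sub_eq_zero] at hj
      rw [mul_comm (∏ t ∈ Finset.Ico k j, (m t : ℤ)) (∏ t ∈ Finset.Ico (b + 1) k, (m t : ℤ)),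
        Finset.prod_Ico_consecutive _ hN hkj, mul_left_comm] at hj
      obtain ⟨t, ht, hpt⟩ :=
        (Nat.prime_iff_prime_int.mp hp).exists_mem_finset_dvd (Dvd.intro _ hj)
      have hle : t ≤ b := hb (Int.natCast_dvd_natCast.mp hpt)
      have := (Finset.mem_Ico.mp ht).1
      omega
  · intro hinf g
    induction g using AddCommGroup.DirectLimit.induction_on with
    | ih i x =>
      obtain ⟨j, hpj, hij⟩ := hinf.exists_gt i
      obtain ⟨c, hc⟩ : (p : ℤ) ∣ ∏ t ∈ Finset.Ico i (j + 1), (m t : ℤ) :=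
        (Int.natCast_dvd_natCast.mpr hpj).trans
          (Finset.dvd_prod_of_mem _ (Finset.mem_Ico.mpr ⟨hij.le, j.lt_succ_self⟩))
      refine ⟨AddCommGroup.DirectLimit.of _ (bondMap m) (j + 1) (c * x), ?_⟩
      rw [← AddCommGroup.DirectLimit.of_f (f := bondMap m) (hij.le.trans j.le_succ) x, ← map_nsmul,
        bondMap_apply, hc, nsmul_eq_mul, mul_assoc]
end

section
/- For every set P of prime numbers there exists a sequence m : ℕ → ℕ with m j ≥ 2 for all j such that, for every prime p, p divides the direct limit G(m) if and only if p ∈ P. (In particular there exist such direct limits whose set of prime divisors is empty, any prescribed finite set, or any prescribed infinite set of primes.) -/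
/-- A prime `p` divides `G(m)` exactly when it divides infinitely many of the (nonzero)
multipliers `m j`. -/
theorem dirLimZ_forall_exists_nsmul_eq_iff {m : ℕ → ℕ} (hm : ∀ j, m j ≠ 0) {p : ℕ}
    (hp : p.Prime) :
    (∀ g : DirLimZ m, ∃ g' : DirLimZ m, p • g' = g) ↔ ∀ N, ∃ j, N ≤ j ∧ p ∣ m j := by
  constructor
  · intro h N
    obtain ⟨g', hg'⟩ := h (AddCommGroup.DirectLimit.of (fun _ : ℕ => ℤ) (bondMap m) N 1)
    induction g' using AddCommGroup.DirectLimit.induction_on with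
    | ih k y =>
      have hNK := le_max_left N k
      have hkK := le_max_right N k
      generalize max N k = K at hNK hkK
      rw [← AddCommGroup.DirectLimit.of_f (G := fun _ : ℕ => ℤ) (f := bondMap m) hNK,
        ← AddCommGroup.DirectLimit.of_f (G := fun _ : ℕ => ℤ) (f := bondMap m) hkK,
        ← map_nsmul, ← sub_eq_zero, ← map_sub] at hg'
      obtain ⟨L, hKL, hL⟩ := AddCommGroup.DirectLimit.of.zero_exact _ _ hg'
      have hprod : ∏ t ∈ Finset.Ico K L, (m t : ℤ) ≠ 0 :=
        Finset.prod_ne_zero_iff.2 fun t _ => Nat.cast_ne_zero.2 (hm t)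
      have heq : (p : ℤ) * bondMap m k K hkK y = ∏ t ∈ Finset.Ico N K, (m t : ℤ) := by
        have := (mul_eq_zero.1 hL).resolve_left hprod
        simpa [bondMap, sub_eq_zero] using this
      obtain ⟨j, hj, hpj⟩ :=
        (Nat.prime_iff_prime_int.1 hp).exists_mem_finset_dvd (Dvd.intro _ heq)
      exact ⟨j, (Finset.mem_Ico.1 hj).1, Int.natCast_dvd_natCast.1 hpj⟩
  · intro h g
    induction g using AddCommGroup.DirectLimit.induction_on with
    | ih i x =>
      obtain ⟨j, hij, hpj⟩ := h i
      have hdvd : (p : ℤ) ∣ bondMap m i (j + 1) (by omega) x :=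
        ((Int.natCast_dvd_natCast.2 hpj).trans
          (Finset.dvd_prod_of_mem (fun t => (m t : ℤ))
            (Finset.mem_Ico.2 ⟨hij, j.lt_succ_self⟩))).mul_right x
      obtain ⟨c, hc⟩ := hdvd
      refine ⟨AddCommGroup.DirectLimit.of (fun _ : ℕ => ℤ) (bondMap m) (j + 1) c, ?_⟩
      rw [← AddCommGroup.DirectLimit.of_f (G := fun _ : ℕ => ℤ) (f := bondMap m)
        (show i ≤ j + 1 by omega) x, hc, ← map_nsmul, nsmul_eq_mul]

/-- Every set `P` of primes is the set of primes dividing infinitely many terms of some sequence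
of integers that are at least `2`. -/
theorem exists_seq_infinitely_often_prime_dvd_iff (P : Set ℕ) (hP : ∀ p ∈ P, p.Prime) :
    ∃ m : ℕ → ℕ, (∀ j, 2 ≤ m j) ∧
      ∀ p : ℕ, p.Prime → ((∀ N, ∃ j, N ≤ j ∧ p ∣ m j) ↔ p ∈ P) := by
  classical
  choose l hl hlp using Nat.exists_infinite_primes
  have hpos : ∀ j, 0 < ∏ q ∈ Finset.range (j + 1) with q ∈ P, q := fun j =>
    Finset.prod_pos fun q hq => (hP q (Finset.mem_filter.1 hq).2).pos
  refine ⟨fun j => l j * ∏ q ∈ Finset.range (j + 1) with q ∈ P, q,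
    fun j => (hlp j).two_le.trans (Nat.le_mul_of_pos_right _ (hpos j)), fun p hp => ⟨fun h => ?_,
    fun h N => ⟨max N p, le_max_left _ _, Dvd.dvd.mul_left (Finset.dvd_prod_of_mem _ ?_) _⟩⟩⟩
  · obtain ⟨j, hj, hpj⟩ := h (p + 1)
    rcases hp.dvd_mul.1 hpj with hd | hd
    · have := (Nat.prime_dvd_prime_iff_eq hp (hlp j)).1 hd
      have := hl j
      omega
    · obtain ⟨q, hq, hpq⟩ := hp.prime.exists_mem_finset_dvd hd
      have hqP := (Finset.mem_filter.1 hq).2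
      rwa [(Nat.prime_dvd_prime_iff_eq hp (hP q hqP)).1 hpq]
  · exact Finset.mem_filter.2 ⟨Finset.mem_range.2 (Nat.lt_succ_of_le (le_max_right _ _)), h⟩

/-- For every set `P` of prime numbers there is a sequence `m : ℕ → ℕ` with `m j ≥ 2`
for all `j` such that, for every prime `p`, `p` divides the direct limit `G(m)` if and
only if `p ∈ P`. -/
theorem exists_directLimit_with_prescribed_prime_divisors
    (P : Set ℕ) (hP : ∀ p ∈ P, p.Prime) :
    ∃ m : ℕ → ℕ, (∀ j : ℕ, 2 ≤ m j) ∧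
      ∀ p : ℕ, p.Prime →
        ((∀ g : DirLimZ m, ∃ g' : DirLimZ m, p • g' = g) ↔ p ∈ P) := by
  obtain ⟨m, hm, h⟩ := exists_seq_infinitely_often_prime_dvd_iff P hP
  exact ⟨m, hm, fun p hp =>
    (dirLimZ_forall_exists_nsmul_eq_iff (fun j => by have := hm j; omega) hp).trans (h p hp)⟩
end

section
/- Let m : ℕ → ℕ be a sequence for which there exist N and an integer c ≥ 1 such that m j = c for all j ≥ N (a 'number-like' system). Then the direct limit G(m) is isomorphic, as an additive abelian group, to the subgroup ℤ[1/c] of ℚ of c-adic rationals, and hence also to ℤ[1/rad(c)] where rad(c) is the product of the distinct prime factors of c. -/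
/-- Rationals with denominator a power of `a` have denominator a power of `b` whenever `a`
divides a power of `b`. -/
theorem adicRationals_subset_of_dvd_pow {a b n : ℕ} (hb : b ≠ 0) (h : a ∣ b ^ n) :
    {q : ℚ | ∃ z : ℤ, ∃ k : ℕ, q = (z : ℚ) / (a : ℚ) ^ k} ⊆
      {q : ℚ | ∃ z : ℤ, ∃ k : ℕ, q = (z : ℚ) / (b : ℚ) ^ k} := by
  rintro q ⟨z, k, rfl⟩
  obtain ⟨d, hd⟩ := h
  have hb' : (b : ℚ) ≠ 0 := by exact_mod_cast hb
  have hd' : (b : ℚ) ^ n = a * d := by exact_mod_cast hd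
  have had : (a : ℚ) * d ≠ 0 := hd' ▸ pow_ne_zero n hb'
  have ha : (a : ℚ) ≠ 0 := left_ne_zero_of_mul had
  have hd0 : (d : ℚ) ≠ 0 := right_ne_zero_of_mul had
  refine ⟨z * d ^ k, n * k, ?_⟩
  rw [pow_mul, hd', mul_pow]
  push_cast
  field_simp

/-- Every nonzero natural number divides a power of its radical. -/
theorem dvd_prod_primeFactors_pow_self {c : ℕ} (hc : c ≠ 0) :
    c ∣ (∏ p ∈ c.primeFactors, p) ^ c := by
  rw [← Finset.prod_pow]
  nth_rewrite 1 [← Nat.prod_factorization_pow_eq_self hc]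
  exact Finset.prod_dvd_prod_of_dvd _ _ fun p _ ↦
    pow_dvd_pow p (Nat.factorization_lt p hc).le

/-- The image of `1` at stage `i` in `ℚ`: the bonding factor from stage `i` to stage `i + N`,
divided by `c ^ i`. -/
def stageCoeff (m : ℕ → ℕ) (N c i : ℕ) : ℚ :=
  (∏ t ∈ Finset.Ico i (i + N), (m t : ℚ)) / (c : ℚ) ^ i

theorem prod_Ico_of_eventually_const {m : ℕ → ℕ} {N c : ℕ} (hm : ∀ j : ℕ, N ≤ j → m j = c)
    {i : ℕ} (hi : N ≤ i) (j : ℕ) :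
    ∏ t ∈ Finset.Ico i j, (m t : ℚ) = (c : ℚ) ^ (j - i) := by
  rw [← Nat.card_Ico]
  refine Finset.prod_eq_pow_card fun t ht ↦ ?_
  rw [hm t (hi.trans (Finset.mem_Ico.mp ht).1)]

theorem prod_Ico_mul_stageCoeff {m : ℕ → ℕ} {N c : ℕ} (hc : c ≠ 0)
    (hm : ∀ j : ℕ, N ≤ j → m j = c) {i j : ℕ} (hij : i ≤ j) :
    (∏ t ∈ Finset.Ico i j, (m t : ℚ)) * stageCoeff m N c j = stageCoeff m N c i := by
  have hc' : (c : ℚ) ≠ 0 := by exact_mod_cast hc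
  obtain ⟨d, rfl⟩ := Nat.exists_eq_add_of_le hij
  have h : (∏ t ∈ Finset.Ico i (i + d), (m t : ℚ)) *
        ∏ t ∈ Finset.Ico (i + d) (i + d + N), (m t : ℚ) =
      (∏ t ∈ Finset.Ico i (i + N), (m t : ℚ)) * (c : ℚ) ^ d := by
    rw [Finset.prod_Ico_consecutive _ (by omega) (by omega),
      ← Finset.prod_Ico_consecutive _ (show i ≤ i + N by omega)
        (show i + N ≤ i + d + N by omega),
      prod_Ico_of_eventually_const hm (by omega) (i + d + N)]
    congr 2
    omega
  rw [stageCoeff, stageCoeff, ← mul_div_assoc, h, pow_add]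
  field_simp

/-- If `m j = c` for all `j ≥ N`, where `c ≥ 1` (a "number-like" system), then the direct
limit `G(m)` is isomorphic, as an additive abelian group, to the subgroup `ℤ[1/c]` of `ℚ`
of `c`-adic rationals, and hence also to `ℤ[1/rad c]` where `rad c` is the product of the
distinct prime factors of `c`. -/
theorem directLimit_number_like_iso_adic_rationals (m : ℕ → ℕ) (N c : ℕ) (hc : 1 ≤ c)
    (hm : ∀ j : ℕ, N ≤ j → m j = c) :
    ∃ e : DirLimZ m →+ ℚ, Function.Injective e ∧
      Set.range e = {q : ℚ | ∃ z : ℤ, ∃ k : ℕ, q = (z : ℚ) / (c : ℚ) ^ k} ∧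
      Set.range e =
        {q : ℚ | ∃ z : ℤ, ∃ k : ℕ, q = (z : ℚ) / ((∏ p ∈ c.primeFactors, p : ℕ) : ℚ) ^ k} := by
  have hc0 : c ≠ 0 := by omega
  have hcQ : (c : ℚ) ≠ 0 := by exact_mod_cast hc0
  let g (i : ℕ) : ℤ →+ ℚ := (AddMonoidHom.mulLeft (stageCoeff m N c i)).comp (Int.castAddHom ℚ)
  have hg_apply (i : ℕ) (x : ℤ) : g i x = stageCoeff m N c i * x := rfl
  have hg (i j : ℕ) (hij : i ≤ j) (x : ℤ) : g j (bondMap m i j hij x) = g i x := by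
    rw [hg_apply, hg_apply, ← prod_Ico_mul_stageCoeff hc0 hm hij]
    simp only [bondMap, AddMonoidHom.coe_mulLeft]
    push_cast
    ring
  let e : DirLimZ m →+ ℚ := AddCommGroup.DirectLimit.lift _ (bondMap m) ℚ g hg
  have he_of (i : ℕ) (x : ℤ) :
      e (AddCommGroup.DirectLimit.of _ (bondMap m) i x) = stageCoeff m N c i * x :=
    AddCommGroup.DirectLimit.lift_of ℚ g hg i x
  have he_range : Set.range e = {q : ℚ | ∃ z : ℤ, ∃ k : ℕ, q = (z : ℚ) / (c : ℚ) ^ k} := by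
    refine Set.Subset.antisymm ?_ ?_
    · rintro _ ⟨y, rfl⟩
      induction y using AddCommGroup.DirectLimit.induction_on with
      | ih i x =>
        refine ⟨(∏ t ∈ Finset.Ico i (i + N), (m t : ℤ)) * x, i, ?_⟩
        rw [he_of, stageCoeff]
        push_cast
        ring
    · rintro _ ⟨z, k, rfl⟩
      refine ⟨AddCommGroup.DirectLimit.of _ (bondMap m) (N + k) z, ?_⟩
      rw [he_of, stageCoeff, prod_Ico_of_eventually_const hm (Nat.le_add_right N k),
        Nat.add_sub_cancel_left, pow_add]
      field_simp
  refine ⟨e, ?_, he_range, he_range.trans ?_⟩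
  · refine (injective_iff_map_eq_zero e).mpr fun y ↦ ?_
    induction y using AddCommGroup.DirectLimit.induction_on with
    | ih i x =>
      intro hx
      rw [he_of, stageCoeff, div_mul_eq_mul_div, div_eq_zero_iff,
        or_iff_left (pow_ne_zero i hcQ)] at hx
      have hbond : bondMap m i (i + N) (Nat.le_add_right i N) x = 0 := by
        simp only [bondMap, AddMonoidHom.coe_mulLeft]
        exact_mod_cast hx
      rw [← AddCommGroup.DirectLimit.of_f (f := bondMap m) (Nat.le_add_right i N), hbond, map_zero]
  · have hrad : (∏ p ∈ c.primeFactors, p) ∣ c ^ 1 := by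
      simpa using Nat.prod_primeFactors_dvd c
    have hrad0 : (∏ p ∈ c.primeFactors, p) ≠ 0 :=
      ne_zero_of_dvd_ne_zero (pow_ne_zero 1 hc0) hrad
    exact Set.Subset.antisymm
      (adicRationals_subset_of_dvd_pow hrad0 (dvd_prod_primeFactors_pow_self hc0))
      (adicRationals_subset_of_dvd_pow hc0 hrad)
end

section
/- Let m : ℕ → ℕ be a sequence for which there exist N and an integer c ≥ 1 such that m j = c for all j ≥ N. Then for every prime p, p divides the direct limit G(m) if and only if p divides c; in particular G(m) has only finitely many prime divisors. -/
/-- The canonical map from the `i`-th stage into the direct limit. -/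
noncomputable abbrev DirLimZ.of (m : ℕ → ℕ) (i : ℕ) : ℤ →+ DirLimZ m :=
  AddCommGroup.DirectLimit.of (fun _ : ℕ => ℤ) (bondMap m) i

theorem DirLimZ.of_eq_of_prod_mul (m : ℕ → ℕ) {i j : ℕ} (hij : i ≤ j) (x : ℤ) :
    DirLimZ.of m i x = DirLimZ.of m j ((∏ t ∈ Finset.Ico i j, (m t : ℤ)) * x) :=
  (AddCommGroup.DirectLimit.of_f (G := fun _ : ℕ => ℤ) (f := bondMap m) hij x).symm

/-- If `p` divides `m j` for arbitrarily large `j`, then `p` divides the direct limit. -/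
theorem DirLimZ.exists_nsmul_eq (m : ℕ → ℕ) (p : ℕ) (h : ∀ i, ∃ j, i ≤ j ∧ p ∣ m j)
    (g : DirLimZ m) : ∃ g' : DirLimZ m, p • g' = g := by
  induction g using AddCommGroup.DirectLimit.induction_on with
  | ih i x =>
    obtain ⟨j, hij, d, hd⟩ := h i
    refine ⟨DirLimZ.of m (j + 1) (d * ((∏ t ∈ Finset.Ico i j, (m t : ℤ)) * x)), ?_⟩
    rw [← map_nsmul]
    refine Eq.trans ?_ (DirLimZ.of_eq_of_prod_mul m (Nat.le_succ_of_le hij) x).symm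
    rw [Finset.prod_Ico_succ_top hij, hd]
    congr 1
    push_cast
    rw [nsmul_eq_mul]
    ring

/-- If the image of `1` from stage `n` is divisible by a prime `p` in the direct limit, and no
later `m j` vanishes, then `p` divides some `m j` with `n ≤ j`. -/
theorem DirLimZ.exists_dvd_of_nsmul_eq (m : ℕ → ℕ) {p n : ℕ} (hp : p.Prime)
    (hm : ∀ j, n ≤ j → m j ≠ 0) (g' : DirLimZ m) (hg' : p • g' = DirLimZ.of m n 1) :
    ∃ j, n ≤ j ∧ p ∣ m j := by
  induction g' using AddCommGroup.DirectLimit.induction_on with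
  | ih i x =>
    change p • DirLimZ.of m i x = _ at hg'
    rw [DirLimZ.of_eq_of_prod_mul m (le_max_left i n),
      DirLimZ.of_eq_of_prod_mul m (le_max_right i n), ← map_nsmul, ← sub_eq_zero,
      ← map_sub] at hg'
    obtain ⟨l, hl, h⟩ := AddCommGroup.DirectLimit.of.zero_exact _ _ hg'
    have hne : (∏ t ∈ Finset.Ico (max i n) l, (m t : ℤ)) ≠ 0 :=
      Finset.prod_ne_zero_iff.mpr fun t ht => by
        exact_mod_cast hm t ((le_max_right i n).trans (Finset.mem_Ico.mp ht).1)
    have heq := sub_eq_zero.mp ((mul_eq_zero.mp h).resolve_left hne)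
    have hdvd : (p : ℤ) ∣ ∏ t ∈ Finset.Ico n (max i n), (m t : ℤ) := by
      rw [mul_one, nsmul_eq_mul] at heq
      exact ⟨_, heq.symm⟩
    obtain ⟨t, ht, hpt⟩ := (Nat.prime_iff_prime_int.mp hp).exists_mem_finset_dvd hdvd
    exact ⟨t, (Finset.mem_Ico.mp ht).1, by exact_mod_cast hpt⟩

/-- If `m j = c` for all `j ≥ N`, where `c ≥ 1`, then for every prime `p`, `p` divides
the direct limit `G(m)` if and only if `p ∣ c`; in particular `G(m)` has only finitely
many prime divisors. -/
theorem directLimit_number_like_prime_divisors (m : ℕ → ℕ) (N c : ℕ) (hc : 1 ≤ c)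
    (hm : ∀ j : ℕ, N ≤ j → m j = c) :
    (∀ p : ℕ, p.Prime →
        ((∀ g : DirLimZ m, ∃ g' : DirLimZ m, p • g' = g) ↔ p ∣ c)) ∧
      {p : ℕ | p.Prime ∧ ∀ g : DirLimZ m, ∃ g' : DirLimZ m, p • g' = g}.Finite := by
  have key : ∀ p : ℕ, p.Prime →
      ((∀ g : DirLimZ m, ∃ g' : DirLimZ m, p • g' = g) ↔ p ∣ c) := by
    refine fun p hp => ⟨fun h => ?_, fun h => ?_⟩
    · obtain ⟨g', hg'⟩ := h (DirLimZ.of m N 1)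
      obtain ⟨j, hj, hpj⟩ := DirLimZ.exists_dvd_of_nsmul_eq m hp
        (fun j hj => by rw [hm j hj]; omega) g' hg'
      rwa [hm j hj] at hpj
    · exact DirLimZ.exists_nsmul_eq m p fun i =>
        ⟨max i N, le_max_left i N, by rwa [hm _ (le_max_right i N)]⟩
  exact ⟨key, (Set.finite_Iic c).subset fun p hp => Nat.le_of_dvd hc ((key p hp.1).mp hp.2)⟩
end

section
/- Let m be a positive integer and p a prime. Then every element of the subgroup ℤ[1/m] of ℚ is divisible by p within ℤ[1/m] (i.e. for every q ∈ ℤ[1/m] there is q' ∈ ℤ[1/m] with p • q' = q) if and only if p divides m. -/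
/-- For a positive integer `m` and a prime `p`, every element of the subgroup `ℤ[1/m]` of
`ℚ` is divisible by `p` within `ℤ[1/m]` if and only if `p` divides `m`. -/
theorem madic_rationals_divisible_by_prime_iff (m : ℕ) (hm : 0 < m) (p : ℕ)
    (hp : p.Prime) :
    (∀ q ∈ {q : ℚ | ∃ z : ℤ, ∃ k : ℕ, q = (z : ℚ) / (m : ℚ) ^ k},
        ∃ q' ∈ {q : ℚ | ∃ z : ℤ, ∃ k : ℕ, q = (z : ℚ) / (m : ℚ) ^ k}, p • q' = q) ↔
      p ∣ m := by
  have hm0 : (m : ℚ) ≠ 0 := by exact_mod_cast hm.ne'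
  constructor
  · intro h
    obtain ⟨q', ⟨z, k, rfl⟩, hq⟩ := h 1 ⟨1, 0, by simp⟩
    have hz : (p : ℤ) * z = (m : ℤ) ^ k := by
      rw [nsmul_eq_mul, ← mul_div_assoc, div_eq_one_iff_eq (pow_ne_zero k hm0)] at hq
      exact_mod_cast hq
    have hdvd : p ∣ m ^ k := by
      have : (p : ℤ) ∣ (m : ℤ) ^ k := ⟨z, hz.symm⟩
      exact_mod_cast this
    exact hp.dvd_of_dvd_pow hdvd
  · rintro ⟨c, hc⟩ _ ⟨z, k, rfl⟩
    refine ⟨((z * c : ℤ) : ℚ) / (m : ℚ) ^ (k + 1), ⟨z * c, k + 1, rfl⟩, ?_⟩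
    have hc' : (m : ℚ) = p * c := by exact_mod_cast hc
    rw [nsmul_eq_mul, ← mul_div_assoc, div_eq_div_iff (pow_ne_zero _ hm0) (pow_ne_zero _ hm0),
      pow_succ]
    push_cast
    linear_combination -(z : ℚ) * (m : ℚ) ^ k * hc'
end

section
/- Let M, M' : ℕ → ℕ be two sequences of nonnegative integers. Define N j = M j * M' j and N' j = M' j * M (j+1). Then the direct limits G(N) and G(N') are isomorphic as additive abelian groups. (This is the algebraic interleaving argument showing that the self-geometric index of a toroidal set is independent of the chosen standard basis of solid tori, where M j and M' j play the roles of the geometric indices N(T'_j, T_j) and N(T_{j+1}, T'_j) of interleaved bases T_j ⊇ T'_j ⊇ T_{j+1}.) -/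
open AddCommGroup in
theorem DirLimZ.of_succ (m : ℕ → ℕ) (i : ℕ) (x : ℤ) :
    DirectLimit.of (fun _ : ℕ => ℤ) (bondMap m) (i + 1) (m i * x) =
      DirectLimit.of (fun _ : ℕ => ℤ) (bondMap m) i x := by
  simpa [bondMap] using
    DirectLimit.of_f (G := fun _ : ℕ => ℤ) (f := bondMap m) (Nat.le_succ i) x

theorem map_bondMap_eq_of_succ {P : Type*} [AddCommMonoid P] {m : ℕ → ℕ} {g : ℕ → ℤ →+ P}
    (hg : ∀ i x, g (i + 1) (m i * x) = g i x) (i j : ℕ) (hij : i ≤ j) (x : ℤ) :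
    g j (bondMap m i j hij x) = g i x := by
  induction j, hij using Nat.le_induction with
  | base => simp [bondMap]
  | succ j hij ih =>
    rw [← ih, ← hg j]
    simp [bondMap, Finset.prod_Ico_succ_top hij, mul_assoc, mul_left_comm]

/-- The homomorphism out of `DirLimZ m` induced by homomorphisms out of the stages that are
compatible with consecutive bonding maps. -/
noncomputable def DirLimZ.lift {P : Type*} [AddCommMonoid P] {m : ℕ → ℕ} (g : ℕ → ℤ →+ P)
    (hg : ∀ i x, g (i + 1) (m i * x) = g i x) : DirLimZ m →+ P :=
  AddCommGroup.DirectLimit.lift _ _ P g (map_bondMap_eq_of_succ hg)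

theorem DirLimZ.lift_of {P : Type*} [AddCommMonoid P] {m : ℕ → ℕ} (g : ℕ → ℤ →+ P)
    (hg : ∀ i x, g (i + 1) (m i * x) = g i x) (i : ℕ) (x : ℤ) :
    DirLimZ.lift g hg (AddCommGroup.DirectLimit.of (fun _ : ℕ => ℤ) (bondMap m) i x) = g i x :=
  AddCommGroup.DirectLimit.lift_of ..

/-- Interleaving: if `N j = M j * M' j` and `N' j = M' j * M (j + 1)`, then the direct
limits `G(N)` and `G(N')` are isomorphic as additive abelian groups. -/
theorem directLimit_interleaved (M M' : ℕ → ℕ) :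
    Nonempty (DirLimZ (fun j => M j * M' j) ≃+ DirLimZ (fun j => M' j * M (j + 1))) := by
  let N : ℕ → ℕ := fun j => M j * M' j
  let N' : ℕ → ℕ := fun j => M' j * M (j + 1)
  let ι (i : ℕ) : ℤ →+ DirLimZ N := AddCommGroup.DirectLimit.of _ (bondMap N) i
  let ι' (i : ℕ) : ℤ →+ DirLimZ N' := AddCommGroup.DirectLimit.of _ (bondMap N') i
  have hι (i : ℕ) (x : ℤ) : ι (i + 1) (M' i * (M i * x)) = ι i x := by
    rw [← DirLimZ.of_succ N i x]
    congr 1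
    simp only [N]
    push_cast
    ring
  have hι' (i : ℕ) (x : ℤ) : ι' (i + 1) (M (i + 1) * (M' i * x)) = ι' i x := by
    rw [← DirLimZ.of_succ N' i x]
    congr 1
    simp only [N']
    push_cast
    ring
  let φ : DirLimZ N →+ DirLimZ N' :=
    DirLimZ.lift (fun i => (ι' i).comp (AddMonoidHom.mulLeft (M i : ℤ))) fun i x => by
      simpa [N, mul_assoc, mul_left_comm] using hι' i (M i * x)
  let ψ : DirLimZ N' →+ DirLimZ N :=
    DirLimZ.lift (fun i => (ι (i + 1)).comp (AddMonoidHom.mulLeft (M' i : ℤ))) fun i x => by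
      simpa [N', mul_assoc, mul_left_comm] using hι (i + 1) (M' i * x)
  have hφ (i : ℕ) (x : ℤ) : φ (ι i x) = ι' i (M i * x) := DirLimZ.lift_of ..
  have hψ (i : ℕ) (x : ℤ) : ψ (ι' i x) = ι (i + 1) (M' i * x) := DirLimZ.lift_of ..
  refine ⟨AddMonoidHom.toAddEquiv φ ψ ?_ ?_⟩
  · refine AddCommGroup.DirectLimit.hom_ext _ fun i => AddMonoidHom.ext fun x => ?_
    change ψ (φ (ι i x)) = ι i x
    rw [hφ, hψ, hι]
  · refine AddCommGroup.DirectLimit.hom_ext _ fun i => AddMonoidHom.ext fun x => ?_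
    change φ (ψ (ι' i x)) = ι' i x
    rw [hψ, hφ, hι']
end

section
/- Let O ⊆ ℝ³ be open, let f : O → ℝ³ be an embedding (a homeomorphism onto its open image O' = f(O)), let K ⊆ O be compact and set K' = f(K). Suppose g : O \ K → O' \ K' is a homeomorphism satisfying dist(f p, g p) < dist(p, K) for every p ∈ O \ K. Then the map ĝ : O → O' defined by ĝ(p) = g(p) for p ∈ O \ K and ĝ(p) = f(p) for p ∈ K is a homeomorphism from O onto O'. -/
open Classical

open Metric Set MeasureTheory Polynomial Topology

section Degree

variable {E : Type*} [NormedAddCommGroup E] [InnerProductSpace ℝ E] [FiniteDimensional ℝ E]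

lemma exists_polynomial_eval_eq_det_one_add_smul (A : E →L[ℝ] E) :
    ∃ p : ℝ[X], p.natDegree ≤ Module.finrank ℝ E ∧ ∀ t, p.eval t = (1 + t • A).det := by
  let b := Module.finBasis ℝ E
  let M := LinearMap.toMatrix b b (A : E →ₗ[ℝ] E)
  refine ⟨_, (natDegree_det_X_add_C_le M 1).trans (by simp), fun t ↦ ?_⟩
  rw [← coe_evalRingHom, RingHom.map_det, ContinuousLinearMap.det, ← LinearMap.det_toMatrix b]
  congr 1
  ext i j
  have h1 : LinearMap.toMatrix b b ((1 + t • A : E →L[ℝ] E) : E →ₗ[ℝ] E) = 1 + t • M := by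
    rw [ContinuousLinearMap.toLinearMap_add, ContinuousLinearMap.toLinearMap_smul, map_add,
      map_smul]
    congr 1
    exact LinearMap.toMatrix_one b
  rw [h1]
  simp [Matrix.one_apply]
  split_ifs <;> simp <;> ring

variable [MeasurableSpace E] [BorelSpace E]

/-- Change of variables for small perturbations of the identity supported in a ball. -/
lemma exists_pos_setIntegral_comp_add_smul {v : E → E} (hv : ContDiff ℝ 1 v) {R : ℝ}
    (hvR : ∀ x, R < ‖x‖ → v x = 0) :
    ∃ ε > 0, ∀ t : ℝ, |t| < ε → ∀ w : E → ℝ,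
      ∫ x in closedBall (0 : E) R, (1 + t • fderiv ℝ v x).det * w (x + t • v x) =
        ∫ x in closedBall (0 : E) R, w x := by
  have hcs : HasCompactSupport v :=
    .intro (isCompact_closedBall 0 R) fun x hx ↦ hvR x (by simpa using hx)
  obtain ⟨C, hC⟩ := hv.lipschitzWith_of_hasCompactSupport hcs one_ne_zero
  have hdet : ∀ᶠ A : E →L[ℝ] E in 𝓝 1, 0 < A.det :=
    ContinuousLinearMap.continuous_det.continuousAt.eventually (lt_mem_nhds (by
      simp [ContinuousLinearMap.det]))
  obtain ⟨ε₁, hε₁, hdet⟩ := Metric.eventually_nhds_iff.1 hdet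
  have hC1 : (0 : ℝ) < C + 1 := by positivity
  refine ⟨min ε₁ 1 / (C + 1), by positivity, fun t ht w ↦ ?_⟩
  rw [lt_div_iff₀ hC1] at ht
  have htC : |t| * C < min ε₁ 1 := by nlinarith [abs_nonneg t]
  have hpos : ∀ x, 0 < (1 + t • fderiv ℝ v x).det := fun x ↦ hdet <| by
    rw [dist_eq_norm, add_sub_cancel_left, norm_smul, Real.norm_eq_abs]
    calc |t| * ‖fderiv ℝ v x‖ ≤ |t| * C := by
          gcongr; exact norm_fderiv_le_of_lipschitz ℝ hC
      _ < ε₁ := htC.trans_le (min_le_left _ _)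
  have happ : ApproximatesLinearOn (fun x ↦ x + t • v x)
      (ContinuousLinearEquiv.refl ℝ E : E →L[ℝ] E) univ (‖t‖₊ * C) := by
    intro x _ y _
    have : x + t • v x - (y + t • v y) - (x - y) = t • (v x - v y) := by
      rw [smul_sub]; abel
    simp only [ContinuousLinearEquiv.coe_refl, ContinuousLinearMap.coe_id', id]
    rw [this, norm_smul, NNReal.coe_mul, coe_nnnorm, mul_assoc]
    gcongr
    simpa [dist_eq_norm] using hC.dist_le_mul x y
  have hc : Subsingleton E ∨
      ‖t‖₊ * C < ‖((ContinuousLinearEquiv.refl ℝ E).symm : E →L[ℝ] E)‖₊⁻¹ := by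
    refine (subsingleton_or_nontrivial E).imp_right fun (_ : Nontrivial E) ↦ ?_
    rw [ContinuousLinearEquiv.refl_symm, ContinuousLinearEquiv.coe_refl,
      ← NNReal.coe_lt_coe, NNReal.coe_inv, coe_nnnorm, ContinuousLinearMap.norm_id]
    simpa using htC.trans_le (min_le_right _ _)
  have hinj : Function.Injective (fun x ↦ x + t • v x) := fun x y h ↦
    happ.injOn hc (mem_univ x) (mem_univ y) h
  have hsurj := happ.surjective hc
  have hfix : ∀ x, R < ‖x‖ → x + t • v x = x := fun x hx ↦ by simp [hvR x hx]
  have himage : (fun x ↦ x + t • v x) '' closedBall 0 R = closedBall 0 R := by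
    ext y
    simp only [mem_image, mem_closedBall_zero_iff]
    constructor
    · rintro ⟨x, hx, rfl⟩
      by_contra! h
      have hx' : x + t • v x = x := hinj (hfix _ h)
      rw [hx'] at h
      exact h.not_ge hx
    · intro hy
      obtain ⟨x, rfl⟩ := hsurj y
      refine ⟨x, ?_, rfl⟩
      by_contra! h
      simp only [hfix x h] at hy
      exact h.not_ge hy
  have hderiv : ∀ x ∈ closedBall (0 : E) R, HasFDerivWithinAt (fun x ↦ x + t • v x)
      (1 + t • fderiv ℝ v x) (closedBall 0 R) x := fun x _ ↦
    ((hasFDerivAt_id x).add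
      (((hv.differentiable one_ne_zero) x).hasFDerivAt.const_smul t)).hasFDerivWithinAt
  have := integral_image_eq_integral_abs_det_fderiv_smul volume measurableSet_closedBall hderiv
    hinj.injOn w
  rw [himage] at this
  rw [this]
  simp only [abs_of_pos (hpos _), smul_eq_mul]

/-- The change of variables formula holds for all perturbations of the identity supported in a
ball and all the polynomial weights `(1 - c ‖x‖²) ^ N`, by polynomiality in the perturbation
parameter. -/
lemma setIntegral_det_mul_one_sub_sq_pow {v : E → E} (hv : ContDiff ℝ 1 v) {R : ℝ}
    (hvR : ∀ x, R < ‖x‖ → v x = 0) (c : ℝ) (N : ℕ) :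
    ∫ x in closedBall (0 : E) R, (1 + fderiv ℝ v x).det * (1 - c * ‖x + v x‖ ^ 2) ^ N =
      ∫ x in closedBall (0 : E) R, (1 - c * ‖x‖ ^ 2) ^ N := by
  obtain ⟨ε, hε, h⟩ := exists_pos_setIntegral_comp_add_smul hv hvR
  set d := Module.finrank ℝ E + N * 2
  set F : ℝ → E → ℝ := fun t x ↦
    (1 + t • fderiv ℝ v x).det * (1 - c * ‖x + t • v x‖ ^ 2) ^ N with hF
  have hpoly : ∀ x, ∃ p : ℝ[X], p.natDegree ≤ d ∧ ∀ t, p.eval t = F t x := by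
    intro x
    obtain ⟨p, hp, hpe⟩ := exists_polynomial_eval_eq_det_one_add_smul (fderiv ℝ v x)
    refine ⟨p * (1 - C c * (C (‖x‖ ^ 2) + C (2 * inner ℝ x (v x)) * X + C (‖v x‖ ^ 2) * X ^ 2)) ^ N,
      natDegree_mul_le.trans (add_le_add hp (natDegree_pow_le.trans ?_)), fun t ↦ ?_⟩
    · gcongr
      compute_degree
    · simp only [hF, eval_mul, eval_pow, eval_sub, eval_one, eval_C, eval_add, eval_X, hpe,
        norm_add_sq_real, norm_smul, inner_smul_right, mul_pow, Real.norm_eq_abs, sq_abs]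
      ring
  have hnode : InjOn (fun i : ℕ ↦ ε / (i + 2)) (Finset.range (d + 1)) := by
    intro i _ j _ hij
    have hi : (i : ℝ) + 2 ≠ 0 := by positivity
    have hj : (j : ℝ) + 2 ≠ 0 := by positivity
    simp only at hij
    field_simp at hij
    exact_mod_cast (by linarith : (i : ℝ) = j)
  set L : ℕ → ℝ := fun i ↦
    (Lagrange.basis (Finset.range (d + 1)) (fun i : ℕ ↦ ε / (i + 2)) i).eval 1
  have hL : ∑ i ∈ Finset.range (d + 1), L i = 1 := by
    rw [← eval_finsetSum, Lagrange.sum_basis hnode (by simp), eval_one]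
  have hFL : ∀ x, F 1 x = ∑ i ∈ Finset.range (d + 1), L i * F (ε / (i + 2)) x := by
    intro x
    obtain ⟨p, hp, hpe⟩ := hpoly x
    have hdeg : p.degree < (Finset.range (d + 1)).card := by
      rw [Finset.card_range]
      exact (degree_le_of_natDegree_le hp).trans_lt (by exact_mod_cast Nat.lt_succ_self d)
    rw [← hpe, Lagrange.eq_interpolate hnode hdeg, Lagrange.interpolate_apply, eval_finsetSum]
    refine Finset.sum_congr rfl fun i _ ↦ ?_
    rw [eval_mul, eval_C, mul_comm, ← hpe]
  have hcont : ∀ t, Continuous (F t) := fun t ↦ by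
    have := hv.continuous
    have := hv.continuous_fderiv one_ne_zero
    exact (ContinuousLinearMap.continuous_det.comp (by fun_prop)).mul (by fun_prop)
  have hint : ∀ t, IntegrableOn (F t) (closedBall 0 R) := fun t ↦
    (hcont t).continuousOn.integrableOn_compact (isCompact_closedBall 0 R)
  calc _ = ∫ x in closedBall (0 : E) R, F 1 x := by simp [hF]
    _ = ∑ i ∈ Finset.range (d + 1), L i * ∫ x in closedBall (0 : E) R, F (ε / (i + 2)) x := by
      simp_rw [hFL]
      rw [integral_finsetSum _ fun i _ ↦ (hint _).const_mul _]
      simp_rw [integral_const_mul]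
    _ = ∑ i ∈ Finset.range (d + 1), L i * ∫ x in closedBall (0 : E) R, (1 - c * ‖x‖ ^ 2) ^ N := by
      refine Finset.sum_congr rfl fun i _ ↦ ?_
      congr 1
      refine h _ ?_ fun x ↦ (1 - c * ‖x‖ ^ 2) ^ N
      rw [abs_of_pos (by positivity), div_lt_iff₀ (by positivity)]
      nlinarith [(Nat.cast_nonneg i : (0 : ℝ) ≤ i)]
    _ = _ := by rw [← Finset.sum_mul, hL, one_mul]

lemma exists_add_eq_zero_of_contDiff {v : E → E} (hv : ContDiff ℝ 1 v) {R : ℝ} (hR : 0 < R)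
    (hvR : ∀ x, R < ‖x‖ → v x = 0) : ∃ x, x + v x = 0 := by
  by_contra! hne
  have hB := isCompact_closedBall (0 : E) R
  have hcv := hv.continuous
  have hnorm : ContinuousOn (fun x ↦ ‖x + v x‖) (closedBall 0 R) := by fun_prop
  have hBne : (closedBall (0 : E) R).Nonempty := ⟨0, by simp [hR.le]⟩
  obtain ⟨x₀, -, hx₀⟩ := hB.exists_isMinOn hBne hnorm
  obtain ⟨x₁, -, hx₁⟩ := hB.exists_isMaxOn hBne hnorm
  set δ := min ‖x₀ + v x₀‖ R
  have hδ : 0 < δ := lt_min (norm_pos_iff.2 (hne _)) hR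
  set M := max (‖x₁ + v x₁‖) R + 1
  have hM : 0 < M := by positivity
  have hRM : R < M := by linarith [le_max_right (‖x₁ + v x₁‖) R]
  have hδM : δ < M := (min_le_right _ _).trans_lt hRM
  have hlow : ∀ x ∈ closedBall (0 : E) R, δ ≤ ‖x + v x‖ := fun x hx ↦
    (min_le_left _ _).trans (hx₀ hx)
  have hup : ∀ x ∈ closedBall (0 : E) R, ‖x + v x‖ ≤ M := fun x hx ↦
    (hx₁ hx).trans (by linarith [le_max_left (‖x₁ + v x₁‖) R])
  set c := (M ^ 2)⁻¹ with hc
  have hc0 : 0 < c := by positivity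
  have hle : ∀ r, 0 ≤ r → r ≤ M → 0 ≤ 1 - c * r ^ 2 := by
    intro r hr hrM
    have : r ^ 2 ≤ M ^ 2 := by gcongr
    rw [hc, inv_mul_eq_div, sub_nonneg]
    exact div_le_one_of_le₀ this (by positivity)
  set a := 1 - c * δ ^ 2 with ha
  set b := 1 - c * (δ / 2) ^ 2 with hb
  have ha0 : 0 < a := by
    rw [ha, hc, inv_mul_eq_div, sub_pos, div_lt_one (by positivity)]
    gcongr
  have hab : a < b := by
    have : 0 < c * δ ^ 2 := by positivity
    rw [ha, hb]; nlinarith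
  set D := ∫ x in closedBall (0 : E) R, |(1 + fderiv ℝ v x).det|
  set m := volume.real (closedBall (0 : E) (δ / 2))
  have hm : 0 < m :=
    ENNReal.toReal_pos (measure_closedBall_pos _ _ (by positivity)).ne'
      measure_closedBall_lt_top.ne
  have hdetc : Continuous fun x ↦ (1 + fderiv ℝ v x).det := by
    have := hv.continuous_fderiv one_ne_zero
    exact ContinuousLinearMap.continuous_det.comp (by fun_prop)
  have key : ∀ N : ℕ, b ^ N * m ≤ D * a ^ N := by
    intro N
    have hsub : closedBall (0 : E) (δ / 2) ⊆ closedBall 0 R :=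
      closedBall_subset_closedBall (by linarith [min_le_right ‖x₀ + v x₀‖ R])
    have hwint : IntegrableOn (fun x : E ↦ (1 - c * ‖x‖ ^ 2) ^ N) (closedBall 0 R) :=
      (by fun_prop : Continuous fun x : E ↦ (1 - c * ‖x‖ ^ 2) ^ N).continuousOn.integrableOn_compact
        hB
    calc b ^ N * m = ∫ x in closedBall (0 : E) (δ / 2), b ^ N := by
          rw [setIntegral_const, smul_eq_mul, mul_comm]
      _ ≤ ∫ x in closedBall (0 : E) (δ / 2), (1 - c * ‖x‖ ^ 2) ^ N := by
          refine setIntegral_mono_on ?_ (hwint.mono_set hsub) measurableSet_closedBall ?_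
          · exact continuousOn_const.integrableOn_compact (isCompact_closedBall _ _)
          · intro x hx
            rw [mem_closedBall_zero_iff] at hx
            exact pow_le_pow_left₀ (ha0.trans hab).le (by rw [hb]; gcongr) N
      _ ≤ ∫ x in closedBall (0 : E) R, (1 - c * ‖x‖ ^ 2) ^ N := by
          refine setIntegral_mono_set hwint ?_ hsub.eventuallyLE
          filter_upwards [ae_restrict_mem measurableSet_closedBall] with x hx
          rw [mem_closedBall_zero_iff] at hx
          exact pow_nonneg (hle _ (norm_nonneg _) (hx.trans hRM.le)) N
      _ = ∫ x in closedBall (0 : E) R,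
            (1 + fderiv ℝ v x).det * (1 - c * ‖x + v x‖ ^ 2) ^ N :=
          (setIntegral_det_mul_one_sub_sq_pow hv hvR c N).symm
      _ ≤ ∫ x in closedBall (0 : E) R, |(1 + fderiv ℝ v x).det| * a ^ N := by
          refine setIntegral_mono_on ?_ ?_ measurableSet_closedBall ?_
          · exact (hdetc.mul (by fun_prop)).continuousOn.integrableOn_compact hB
          · exact (hdetc.abs.mul continuous_const).continuousOn.integrableOn_compact hB
          · intro x hx
            have h0 := hle _ (norm_nonneg _) (hup x hx)
            refine mul_le_mul (le_abs_self _) (pow_le_pow_left₀ h0 ?_ N) (pow_nonneg h0 N)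
              (abs_nonneg _)
            rw [ha]
            gcongr
            exact hlow x hx
      _ = D * a ^ N := integral_mul_const _ _
  obtain ⟨N, hN⟩ := pow_unbounded_of_one_lt (D / m) ((one_lt_div ha0).2 hab)
  rw [div_pow, div_lt_div_iff₀ hm (by positivity)] at hN
  exact hN.not_ge (key N)

end Degree

section Brouwer

variable {E : Type*} [NormedAddCommGroup E] [InnerProductSpace ℝ E] [FiniteDimensional ℝ E]

/-- A form of **Brouwer's fixed point theorem**: a bounded continuous perturbation of the identity
has a zero. -/
theorem Continuous.exists_add_eq_zero_of_bounded {u : E → E} (hu : Continuous u) {r : ℝ}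
    (hr : ∀ x, ‖u x‖ ≤ r) : ∃ x, x + u x = 0 := by
  borelize E
  by_contra! hne
  have hr0 : 0 ≤ r := (norm_nonneg _).trans (hr 0)
  obtain ⟨x₀, -, hx₀⟩ := (isCompact_closedBall (0 : E) (r + 1)).exists_isMinOn
    ⟨0, by simp; linarith⟩ (by fun_prop : ContinuousOn (fun x ↦ ‖x + u x‖) _)
  have hδ : 0 < ‖x₀ + u x₀‖ := norm_pos_iff.2 (hne _)
  obtain ⟨v, hv, hvu, -⟩ := hu.exists_contDiff_approx 1
    (continuous_const (y := min ‖x₀ + u x₀‖ 1)) fun _ ↦ lt_min hδ one_pos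
  let χ : ContDiffBump (0 : E) := ⟨r + 1, r + 2, by linarith, by linarith⟩
  obtain ⟨x, hx⟩ := exists_add_eq_zero_of_contDiff (v := fun x ↦ χ x • v x) (R := r + 2)
    (χ.contDiff.smul (by exact_mod_cast hv)) (by linarith) fun x hx ↦ by
      rw [χ.zero_of_le_dist (by simpa [dist_zero_right] using hx.le), zero_smul]
  have hvr : ‖v x‖ ≤ r + 1 := by
    have h1 := (hvu x).trans_le (min_le_right _ _)
    rw [dist_eq_norm] at h1
    linarith [norm_sub_norm_le (v x) (u x), hr x]
  have hxr : x ∈ closedBall (0 : E) (r + 1) := by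
    rw [mem_closedBall_zero_iff, eq_neg_of_add_eq_zero_left hx, norm_neg, norm_smul,
      Real.norm_of_nonneg χ.nonneg]
    nlinarith [χ.le_one (x := x), norm_nonneg (v x)]
  rw [χ.one_of_mem_closedBall hxr, one_smul] at hx
  have h1 := (hvu x).trans_le (min_le_left _ _)
  have h2 : ‖x₀ + u x₀‖ ≤ ‖x + u x‖ := hx₀ hxr
  rw [dist_comm, dist_eq_norm, ← add_sub_add_left_eq_sub _ _ x, hx, sub_zero] at h1
  exact h1.not_ge h2

lemma exists_eq_zero_of_norm_sub_le {a : E} {r : ℝ} (hr : 0 < r) {F : E → E}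
    (hF : ContinuousOn F (closedBall a r)) (hFr : ∀ x ∈ closedBall a r, ‖F x - (x - a)‖ ≤ r) :
    ∃ x ∈ closedBall a r, F x = 0 := by
  have := Metric.instTietzeExtensionClosedBall ℝ (0 : E) hr
  obtain ⟨u, hur, hu⟩ := ContinuousMap.exists_forall_mem_restrict_eq (t := closedBall (0 : E) r)
    (isClosed_closedBall (x := a) (ε := r))
    ⟨fun x ↦ F x - (x - a), hF.domRestrict.sub (by fun_prop)⟩ fun x ↦ by
      exact mem_closedBall_zero_iff.2 (hFr x x.2)
  simp only [mem_closedBall_zero_iff] at hur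
  obtain ⟨z, hz⟩ := Continuous.exists_add_eq_zero_of_bounded
    (u := fun z ↦ u (a + z)) (by fun_prop) fun z ↦ hur _
  have hzr : a + z ∈ closedBall a r := by
    rw [mem_closedBall_iff_norm, add_sub_cancel_left, eq_neg_of_add_eq_zero_left hz, norm_neg]
    exact hur _
  have huz : u (a + z) = F (a + z) - (a + z - a) := DFunLike.congr_fun hu ⟨a + z, hzr⟩
  refine ⟨a + z, hzr, ?_⟩
  rw [huz] at hz
  simpa using hz

/-- **Invariance of domain**, local form. -/
theorem image_closedBall_mem_nhds_of_injOn {f : E → E} {a : E} {r : ℝ} (hr : 0 < r)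
    (hf : ContinuousOn f (closedBall a r)) (hinj : InjOn f (closedBall a r)) :
    f '' closedBall a r ∈ 𝓝 (f a) := by
  borelize E
  by_contra hnot
  set B := closedBall a r with hB
  have haB : a ∈ B := mem_closedBall_self hr.le
  have hBc : IsCompact B := isCompact_closedBall a r
  have hfB : IsCompact (f '' B) := hBc.image_of_continuousOn hf
  have hemb : IsClosedEmbedding (B.domRestrict f) :=
    have := isCompact_iff_compactSpace.1 hBc
    hf.domRestrict.isClosedEmbedding (injOn_iff_injective.1 hinj)
  obtain ⟨G, hG⟩ := ContinuousMap.exists_extension hemb ⟨fun x : B ↦ (x : E) - a, by fun_prop⟩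
  have hGf : ∀ x ∈ B, G (f x) = x - a := fun x hx ↦ DFunLike.congr_fun hG ⟨x, hx⟩
  have hGa : G (f a) = 0 := by rw [hGf a haB, sub_self]
  obtain ⟨ε, hε, hGε⟩ := Metric.continuousAt_iff.1 G.continuous.continuousAt (r / 4) (by positivity)
  obtain ⟨c, hc, hcB⟩ : ∃ c ∈ ball (f a) (ε / 2), c ∉ f '' B := by
    by_contra! h
    exact hnot (Filter.mem_of_superset (ball_mem_nhds _ (by positivity)) h)
  have hS : IsCompact (f '' B \ ball c (ε / 2)) := hfB.diff isOpen_ball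
  have hGS : ∀ y ∈ f '' B \ ball c (ε / 2), 0 < ‖G y‖ := by
    rintro _ ⟨⟨x, hx, rfl⟩, hxc⟩
    rw [hGf x hx, norm_pos_iff, sub_ne_zero]
    rintro rfl
    exact hxc (mem_ball_comm.1 hc)
  obtain ⟨δ, hδ, hGδ⟩ : ∃ δ > 0, ∀ y ∈ f '' B \ ball c (ε / 2), δ ≤ ‖G y‖ := by
    rcases (f '' B \ ball c (ε / 2)).eq_empty_or_nonempty with h | h
    · exact ⟨1, one_pos, by simp [h]⟩
    · obtain ⟨y, hy, hmin⟩ := hS.exists_isMinOn h (by fun_prop : ContinuousOn (fun y ↦ ‖G y‖) _)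
      exact ⟨_, hGS y hy, fun z hz ↦ hmin hz⟩
  set η := min (δ / 4) (r / 8)
  have hη : 0 < η := by positivity
  obtain ⟨P, hP, hPG, -⟩ := G.continuous.exists_contDiff_approx 1
    (continuous_const (y := η)) fun _ ↦ hη
  have hnull : volume (P '' sphere c (ε / 2)) = 0 :=
    addHaar_image_eq_zero_of_differentiableOn_of_addHaar_eq_zero volume
      (hP.differentiable (by simp)).differentiableOn
      (Measure.addHaar_sphere_of_ne_zero volume c (by positivity))
  obtain ⟨b, hbP, hb⟩ : ∃ b, b ∉ P '' sphere c (ε / 2) ∧ ‖b‖ < η := by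
    by_contra! h
    have hsub : ball (0 : E) η ⊆ P '' sphere c (ε / 2) := fun b hb ↦ by
      by_contra hbP
      exact (h b hbP).not_gt (by simpa using hb)
    exact (measure_ball_pos volume (0 : E) hη).ne' (measure_mono_null hsub hnull)
  have hQG : ∀ y, ‖P y - b - G y‖ < 2 * η := fun y ↦ by
    have h1 := hPG y
    rw [dist_eq_norm] at h1
    calc ‖P y - b - G y‖ = ‖(P y - G y) - b‖ := by congr 1; abel
      _ ≤ ‖P y - G y‖ + ‖b‖ := norm_sub_le _ _
      _ < 2 * η := by linarith
  let Φ : E → E := fun y ↦ c + max (ε / 2 / ‖y - c‖) 1 • (y - c)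
  have hΦfar : ∀ y, y ≠ c → ε / 2 ≤ dist y c → Φ y = y := fun y hy h ↦ by
    have hyc : 0 < ‖y - c‖ := norm_pos_iff.2 (sub_ne_zero.2 hy)
    rw [dist_eq_norm] at h
    simp only [Φ]
    rw [max_eq_right ((div_le_one hyc).2 h), one_smul, add_sub_cancel]
  have hΦnear : ∀ y, y ≠ c → dist y c < ε / 2 → Φ y ∈ sphere c (ε / 2) := fun y hy h ↦ by
    have hyc : 0 < ‖y - c‖ := norm_pos_iff.2 (sub_ne_zero.2 hy)
    rw [dist_eq_norm] at h
    simp only [Φ]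
    rw [max_eq_left ((one_le_div hyc).2 h.le), mem_sphere_iff_norm, add_sub_cancel_left,
      norm_smul, Real.norm_of_nonneg (by positivity), div_mul_cancel₀ _ hyc.ne']
  have hne : ∀ x ∈ B, f x ≠ c := fun x hx h ↦ hcB ⟨x, hx, h⟩
  have hcont : ContinuousOn (fun x ↦ P (Φ (f x)) - b) B := by
    refine (hP.continuous.comp_continuousOn ?_).sub continuousOn_const
    refine continuousOn_const.add (ContinuousOn.smul (ContinuousOn.sup ?_ continuousOn_const) ?_)
    · exact continuousOn_const.div (hf.sub continuousOn_const).norm fun x hx ↦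
        norm_ne_zero_iff.2 (sub_ne_zero.2 (hne x hx))
    · exact hf.sub continuousOn_const
  have hη8 : η ≤ r / 8 := min_le_right _ _
  have hη4 : η ≤ δ / 4 := min_le_left _ _
  obtain ⟨x, hx, hx0⟩ := exists_eq_zero_of_norm_sub_le hr hcont fun x hx ↦ by
    rw [← hGf x hx]
    rcases le_or_gt (ε / 2) (dist (f x) c) with h | h
    · rw [hΦfar _ (hne x hx) h]
      linarith [hQG (f x)]
    · have hsph := hΦnear _ (hne x hx) h
      have hball : ∀ y, dist y c ≤ ε / 2 → ‖G y‖ < r / 4 := fun y hy ↦ by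
        have := hGε (x := y) (by linarith [dist_triangle y c (f a), mem_ball.1 hc])
        rwa [hGa, dist_zero_right] at this
      have h1 := hball _ h.le
      have h2 := hball _ (mem_sphere.1 hsph).le
      calc ‖P (Φ (f x)) - b - G (f x)‖
          = ‖(P (Φ (f x)) - b - G (Φ (f x))) + G (Φ (f x)) - G (f x)‖ := by congr 1; abel
        _ ≤ ‖P (Φ (f x)) - b - G (Φ (f x))‖ + ‖G (Φ (f x))‖ + ‖G (f x)‖ :=
          (norm_sub_le _ _).trans (by gcongr; exact norm_add_le _ _)
        _ ≤ r := by linarith [hQG (Φ (f x))]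
  rcases le_or_gt (ε / 2) (dist (f x) c) with h | h
  · rw [hΦfar _ (hne x hx) h] at hx0
    have h1 := hQG (f x)
    rw [hx0, zero_sub, norm_neg] at h1
    linarith [hGδ (f x) ⟨⟨x, hx, rfl⟩, by simpa using h⟩]
  · exact hbP ⟨_, hΦnear _ (hne x hx) h, sub_eq_zero.1 hx0⟩

/-- **Invariance of domain**. -/
theorem IsOpen.isOpenEmbedding_of_continuous_of_injective {U : Set E} (hU : IsOpen U) {f : U → E}
    (hf : Continuous f) (hinj : Function.Injective f) : IsOpenEmbedding f := by
  refine .of_continuous_injective_isOpenMap hf hinj (isOpenMap_iff_nhds_le.2 fun a s hs ↦ ?_)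
  let F : E → E := fun x ↦ if hx : x ∈ U then f ⟨x, hx⟩ else 0
  have hF : ∀ x : U, F x = f x := fun x ↦ by simp [F]
  have hres : U.domRestrict F = f := funext hF
  have hFc : ContinuousOn F U := continuousOn_iff_continuous_domRestrict.2 (hres ▸ hf)
  have hFi : InjOn F U := injOn_iff_injective.2 (hres ▸ hinj)
  have hs' : (↑) '' (f ⁻¹' s) ∈ 𝓝 (a : E) := hU.isOpenEmbedding_subtypeVal.image_mem_nhds.2 hs
  obtain ⟨r, hr, hsub⟩ := Metric.nhds_basis_closedBall.mem_iff.1 hs'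
  have hBU : closedBall (a : E) r ⊆ U := hsub.trans (by simp)
  rw [← hF]
  refine Filter.mem_of_superset
    (image_closedBall_mem_nhds_of_injOn hr (hFc.mono hBU) (hFi.mono hBU)) ?_
  rintro _ ⟨x, hx, rfl⟩
  obtain ⟨y, hy, rfl⟩ := hsub hx
  rwa [hF]

end Brouwer

/-- Let `O ⊆ ℝ³` be open, let `f` restricted to `O` be an embedding onto its open image
`O' = f '' O`, let `K ⊆ O` be compact and `K' = f '' K`.  If `g : O \ K → O' \ K'` is a
homeomorphism satisfying `dist (f p) (g p) < dist (p, K)` for every `p ∈ O \ K`, then the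
map `ĝ : O → O'` given by `ĝ p = f p` for `p ∈ K` and `ĝ p = g p` for `p ∈ O \ K` is a
homeomorphism from `O` onto `O'`. -/
theorem extend_approx_homeomorphism_over_compact
    (O : Set (EuclideanSpace ℝ (Fin 3))) (hO : IsOpen O)
    (f : EuclideanSpace ℝ (Fin 3) → EuclideanSpace ℝ (Fin 3))
    (hf : Topology.IsOpenEmbedding (O.restrict f))
    (K : Set (EuclideanSpace ℝ (Fin 3))) (hK : IsCompact K) (hKO : K ⊆ O)
    (g : EuclideanSpace ℝ (Fin 3) → EuclideanSpace ℝ (Fin 3))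
    (hg : Set.BijOn g (O \ K) (f '' O \ f '' K))
    (hghomeo : IsHomeomorph (Set.MapsTo.restrict g (O \ K) (f '' O \ f '' K) hg.mapsTo))
    (happrox : ∀ p ∈ O \ K, dist (f p) (g p) < Metric.infDist p K) :
    Topology.IsEmbedding
        (fun p : O => if (p : EuclideanSpace ℝ (Fin 3)) ∈ K then f p else g p) ∧
      Set.range (fun p : O => if (p : EuclideanSpace ℝ (Fin 3)) ∈ K then f p else g p) =
        f '' O := by
  have hfc : Continuous (fun p : O ↦ f p) := hf.continuous
  have hfi : InjOn f O := injOn_iff_injective.2 hf.injective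
  have hgc : ContinuousOn g (O \ K) :=
    continuousOn_iff_continuous_domRestrict.2 (continuous_subtype_val.comp hghomeo.continuous)
  have hgO : IsOpen (O \ K) := hO.sdiff hK.isClosed
  set h : O → EuclideanSpace ℝ (Fin 3) := fun p ↦ if (p : EuclideanSpace ℝ (Fin 3)) ∈ K
    then f p else g p
  have hK' : ∀ p : O, (p : EuclideanSpace ℝ (Fin 3)) ∈ K → h p = f p := fun p hp ↦ if_pos hp
  have hKc : ∀ p : O, (p : EuclideanSpace ℝ (Fin 3)) ∉ K → h p = g p := fun p hp ↦ if_neg hp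
  have hcont : Continuous h := by
    refine continuous_iff_continuousAt.2 fun p ↦ ?_
    by_cases hp : (p : EuclideanSpace ℝ (Fin 3)) ∈ K
    · have hle : ∀ q : O, dist (h q) (f p) ≤
          infDist (q : EuclideanSpace ℝ (Fin 3)) K + dist (f q) (f p) := fun q ↦ by
        by_cases hq : (q : EuclideanSpace ℝ (Fin 3)) ∈ K
        · rw [hK' q hq]
          linarith [infDist_nonneg (x := (q : EuclideanSpace ℝ (Fin 3))) (s := K)]
        · rw [hKc q hq]
          have := happrox q ⟨q.2, hq⟩
          rw [dist_comm] at this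
          linarith [dist_triangle (g q) (f q) (f p)]
      have hlim : Filter.Tendsto (fun q : O ↦ infDist (q : EuclideanSpace ℝ (Fin 3)) K +
          dist (f q) (f p)) (𝓝 p) (𝓝 0) := by
        have : Continuous fun q : O ↦ infDist (q : EuclideanSpace ℝ (Fin 3)) K +
          dist (f q) (f p) := ((continuous_infDist_pt K).comp continuous_subtype_val).add
            (hfc.dist continuous_const)
        simpa [infDist_zero_of_mem hp] using this.tendsto p
      rw [ContinuousAt, hK' p hp]
      exact tendsto_iff_dist_tendsto_zero.2 (squeeze_zero (fun _ ↦ dist_nonneg) hle hlim)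
    · have hgp : ContinuousAt (fun q : O ↦ g q) p :=
        (hgc.continuousAt (hgO.mem_nhds ⟨p.2, hp⟩)).comp continuous_subtype_val.continuousAt
      refine hgp.congr ?_
      filter_upwards [(hK.isClosed.isOpen_compl.preimage continuous_subtype_val).mem_nhds hp]
        with q hq using (hKc q hq).symm
  have hinj : Function.Injective h := by
    intro p q hpq
    by_cases hp : (p : EuclideanSpace ℝ (Fin 3)) ∈ K <;>
    by_cases hq : (q : EuclideanSpace ℝ (Fin 3)) ∈ K
    · rw [hK' p hp, hK' q hq] at hpq
      exact Subtype.ext (hfi p.2 q.2 hpq)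
    · rw [hK' p hp, hKc q hq] at hpq
      exact absurd ⟨_, hp, hpq⟩ (hg.mapsTo ⟨q.2, hq⟩).2
    · rw [hKc p hp, hK' q hq] at hpq
      exact absurd ⟨_, hq, hpq.symm⟩ (hg.mapsTo ⟨p.2, hp⟩).2
    · rw [hKc p hp, hKc q hq] at hpq
      exact Subtype.ext (hg.injOn ⟨p.2, hp⟩ ⟨q.2, hq⟩ hpq)
  refine ⟨(hO.isOpenEmbedding_of_continuous_of_injective hcont hinj).isEmbedding, ?_⟩
  refine Subset.antisymm ?_ fun y hy ↦ ?_
  · rintro _ ⟨p, rfl⟩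
    by_cases hp : (p : EuclideanSpace ℝ (Fin 3)) ∈ K
    · exact hK' p hp ▸ mem_image_of_mem f p.2
    · exact hKc p hp ▸ (hg.mapsTo ⟨p.2, hp⟩).1
  · by_cases hyK : y ∈ f '' K
    · obtain ⟨p, hp, rfl⟩ := hyK
      exact ⟨⟨p, hKO hp⟩, hK' _ hp⟩
    · obtain ⟨p, hp, rfl⟩ := hg.surjOn ⟨hy, hyK⟩
      exact ⟨⟨p, hp.1⟩, hKc _ hp.2⟩
end

section
/- Let f : ℝ³ → ℝ³ be a homeomorphism and P ⊆ ℝ³ a compact set with f(P) contained in the interior of P; put P_k = f^k(P) for k ≥ 0 and K = ⋂_{k ≥ 0} P_k. Let (φ_k)_{k ≥ 0} be a strictly decreasing sequence of positive reals converging to 0 such that for every k the closed φ_k-neighbourhood of P_{k+1} is contained in P_k. Define Φ on ℝ³ \ K by Φ(p) = φ_1 if p ∉ P_0 and Φ(p) = φ_{k+1} if p ∈ P_k \ P_{k+1}. Suppose g : ℝ³ \ K → ℝ³ \ K is a homeomorphism with dist(f²(p), g(p)) < Φ(p) for every p ∈ ℝ³ \ K. Then the map ĝ : ℝ³ → ℝ³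 defined by ĝ = g on ℝ³ \ K and ĝ = f² on K is a homeomorphism of ℝ³ satisfying ĝ(P_k) ⊆ P_{k+1} for every k ≥ 0, ĝ(K) = K, and ⋂_{k ≥ 0} ĝ^k(P) = K. -/
open Classical

/-- A point of a member of a sequence of sets that is not in the intersection of the sequence
lies in the difference of two later consecutive members. -/
theorem exists_mem_diff_succ_of_notMem_iInter {α : Type*} {S : ℕ → Set α} {p : α} {k : ℕ}
    (hp : p ∈ S k) (hS : Antitone S) (hpK : p ∉ ⋂ n, S n) :
    ∃ j, k ≤ j ∧ p ∈ S j \ S (j + 1) := by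
  by_contra! h
  refine hpK (Set.mem_iInter.2 fun n => ?_)
  have key : ∀ m, p ∈ S (k + m) := by
    intro m
    induction m with
    | zero => exact hp
    | succ m ih =>
      by_contra hn
      exact h (k + m) (Nat.le_add_right k m) ⟨ih, hn⟩
  exact hS (Nat.le_add_left n k) (key n)

/-- A continuous bijection of a proper metric space at bounded distance from a homeomorphism is a
homeomorphism. -/
theorem isHomeomorph_of_dist_homeomorph_le {X : Type*} [MetricSpace X] [ProperSpace X]
    (h : X ≃ₜ X) {F : X → X} (hF : Continuous F) (hbij : Function.Bijective F) {C : ℝ}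
    (hC : ∀ x, dist (h x) (F x) ≤ C) : IsHomeomorph F := by
  have hproper : IsProperMap F := by
    refine isProperMap_iff_isCompact_preimage.2 ⟨hF, fun B hB => ?_⟩
    have hcomp : IsCompact (h ⁻¹' Metric.cthickening C B) :=
      h.isCompact_preimage.2 hB.cthickening
    refine hcomp.of_isClosed_subset (hB.isClosed.preimage hF) fun x hx => ?_
    exact Metric.mem_cthickening_of_dist_le (h x) (F x) C B hx (hC x)
  exact isHomeomorph_iff_continuous_isClosedMap_bijective.2 ⟨hF, hproper.isClosedMap, hbij⟩

/-- Let `f` be a homeomorphism of `ℝ³`, `P` compact with `f '' P ⊆ interior P`,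
`P_k = f^[k] '' P` and `K = ⋂ k, P_k`.  Let `φ` be a strictly decreasing sequence of
positive reals tending to `0` with the closed `φ k`-neighbourhood of `P_(k+1)` contained
in `P_k`, and let `Φ` equal `φ 1` off `P_0` and `φ (k+1)` on `P_k \ P_(k+1)`.  If
`g : ℝ³ \ K → ℝ³ \ K` is a homeomorphism with `dist (f² p) (g p) < Φ p` off `K`, then
`ĝ` defined as `g` off `K` and as `f²` on `K` is a homeomorphism of `ℝ³` with
`ĝ '' P_k ⊆ P_(k+1)` for all `k`, `ĝ '' K = K`, and `⋂ k, ĝ^[k] '' P = K`. -/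
theorem extend_approx_homeomorphism_attractor
    (f : EuclideanSpace ℝ (Fin 3) ≃ₜ EuclideanSpace ℝ (Fin 3))
    (P : Set (EuclideanSpace ℝ (Fin 3))) (hP : IsCompact P)
    (hfP : f '' P ⊆ interior P)
    (K : Set (EuclideanSpace ℝ (Fin 3))) (hKdef : K = ⋂ k : ℕ, (⇑f)^[k] '' P)
    (φ : ℕ → ℝ) (hφpos : ∀ k : ℕ, 0 < φ k) (hφanti : StrictAnti φ)
    (hφlim : Filter.Tendsto φ Filter.atTop (nhds 0))
    (hφnbhd : ∀ k : ℕ, Metric.cthickening (φ k) ((⇑f)^[k + 1] '' P) ⊆ (⇑f)^[k] '' P)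
    (Φ : EuclideanSpace ℝ (Fin 3) → ℝ)
    (hΦout : ∀ p ∉ P, Φ p = φ 1)
    (hΦin : ∀ k : ℕ, ∀ p ∈ (⇑f)^[k] '' P \ (⇑f)^[k + 1] '' P, Φ p = φ (k + 1))
    (g : EuclideanSpace ℝ (Fin 3) → EuclideanSpace ℝ (Fin 3))
    (hg : Set.BijOn g Kᶜ Kᶜ)
    (hghomeo : IsHomeomorph (Set.MapsTo.restrict g Kᶜ Kᶜ hg.mapsTo))
    (happrox : ∀ p ∉ K, dist (f (f p)) (g p) < Φ p) :
    IsHomeomorph (fun p => if p ∈ K then f (f p) else g p) ∧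
      (∀ k : ℕ, (fun p => if p ∈ K then f (f p) else g p) '' ((⇑f)^[k] '' P) ⊆
        (⇑f)^[k + 1] '' P) ∧
      (fun p => if p ∈ K then f (f p) else g p) '' K = K ∧
      (⋂ k : ℕ, (fun p => if p ∈ K then f (f p) else g p)^[k] '' P) = K := by
  set S : ℕ → Set (EuclideanSpace ℝ (Fin 3)) := fun k => (⇑f)^[k] '' P with hSdef
  set G : EuclideanSpace ℝ (Fin 3) → EuclideanSpace ℝ (Fin 3) :=
    fun p => if p ∈ K then f (f p) else g p with hGdef
  have hGK : ∀ p ∈ K, G p = f (f p) := fun p hp => if_pos hp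
  have hGn : ∀ p ∉ K, G p = g p := fun p hp => if_neg hp
  have hS0 : S 0 = P := by simp [hSdef]
  have hSsucc : ∀ k, f '' S k = S (k + 1) := fun k => by
    simp only [hSdef, Function.iterate_succ', Set.image_comp]
  have hSanti : Antitone S :=
    antitone_nat_of_succ_le fun k => (Metric.self_subset_cthickening _).trans (hφnbhd k)
  have hKS : ∀ k, K ⊆ S k := fun k => hKdef ▸ Set.iInter_subset S k
  have hKclosed : IsClosed K := by
    rw [hKdef]
    exact isClosed_iInter fun k => (hP.image (f.continuous.iterate k)).isClosed
  have hfK : f '' K = K := by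
    rw [hKdef, Set.image_iInter f.bijective]
    change ⋂ k, f '' S k = ⋂ k, S k
    simp only [hSsucc]
    exact hSanti.iInter_nat_add 1
  have hffK : (fun p => f (f p)) '' K = K := by
    rw [← Set.image_image f f, hfK, hfK]
  have hΦle : ∀ k, ∀ p ∈ S k, p ∉ K → Φ p ≤ φ (k + 1) := fun k p hp hpK => by
    obtain ⟨j, hkj, hj⟩ := exists_mem_diff_succ_of_notMem_iInter hp hSanti (hKdef ▸ hpK)
    rw [hΦin j p hj]
    exact hφanti.antitone (by omega)
  have hdist : ∀ k, ∀ p ∈ S k, dist (f (f p)) (G p) ≤ φ (k + 1) := fun k p hp => by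
    by_cases hpK : p ∈ K
    · rw [hGK p hpK, dist_self]
      exact (hφpos _).le
    · rw [hGn p hpK]
      exact (happrox p hpK).le.trans (hΦle k p hp hpK)
  have hdist_all : ∀ p, dist (f (f p)) (G p) ≤ φ 1 := fun p => by
    by_cases hpP : p ∈ P
    · exact hdist 0 p (hS0.symm ▸ hpP)
    · have hpK : p ∉ K := fun h => hpP (hS0 ▸ hKS 0 h)
      rw [hGn p hpK, ← hΦout p hpP]
      exact (happrox p hpK).le
  have hGimK : G '' K = K := (Set.image_congr hGK).trans hffK
  have hGimS : ∀ k, G '' S k ⊆ S (k + 1) := by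
    rintro k _ ⟨p, hp, rfl⟩
    refine hφnbhd (k + 1) (Metric.mem_cthickening_of_dist_le (G p) (f (f p)) _ _ ?_ ?_)
    · change f (f p) ∈ S (k + 1 + 1)
      rw [← hSsucc, ← hSsucc]
      exact Set.mem_image_of_mem f (Set.mem_image_of_mem f hp)
    · rw [dist_comm]
      exact hdist k p hp
  have hSnhds : ∀ k, ∀ p ∈ K, S k ∈ nhds p := fun k p hp =>
    Filter.mem_of_superset (Metric.ball_mem_nhds p (hφpos k)) fun q hq =>
      hφnbhd k (Metric.mem_cthickening_of_dist_le q p _ _ (hKS (k + 1) hp)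
        (Metric.mem_ball.1 hq).le)
  have hgcont : ContinuousOn g Kᶜ := by
    rw [continuousOn_iff_continuous_domRestrict]
    exact continuous_subtype_val.comp hghomeo.continuous
  have hGcont : Continuous G := by
    refine continuous_iff_continuousAt.2 fun p => ?_
    by_cases hp : p ∈ K
    · have hlim : Filter.Tendsto (fun q => dist (f (f q)) (G q)) (nhds p) (nhds 0) := by
        refine Metric.tendsto_nhds.2 fun ε hε => ?_
        obtain ⟨k, hk⟩ := (hφlim.eventually (gt_mem_nhds hε)).exists
        filter_upwards [hSnhds k p hp] with q hq
        rw [Real.dist_0_eq_abs, abs_of_nonneg dist_nonneg]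
        exact (hdist k q hq).trans_lt ((hφanti k.lt_succ_self).trans hk)
      have hff : Filter.Tendsto (fun q => f (f q)) (nhds p) (nhds (G p)) := by
        rw [hGK p hp]
        exact (f.continuous.comp f.continuous).tendsto p
      exact (tendsto_iff_of_dist hlim).1 hff
    · have hopen : Kᶜ ∈ nhds p := hKclosed.isOpen_compl.mem_nhds hp
      refine (hgcont.continuousAt hopen).congr ?_
      filter_upwards [hopen] with q hq
      exact (hGn q hq).symm
  have hGbij : Function.Bijective G := by
    have hbK : Set.BijOn G K K :=
      ⟨Set.mapsTo_iff_image_subset.2 hGimK.subset, fun x hx y hy hxy => by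
        rw [hGK x hx, hGK y hy] at hxy
        exact f.injective (f.injective hxy), hGimK.superset⟩
    have hbc : Set.BijOn G Kᶜ Kᶜ := hg.congr fun q hq => (hGn q hq).symm
    have hun := hbK.union hbc ?_
    · rwa [Set.union_compl_self, Set.bijOn_univ] at hun
    · refine (Set.injOn_union disjoint_compl_right).2 ⟨hbK.injOn, hbc.injOn, ?_⟩
      intro x hx y hy hxy
      exact hbc.mapsTo hy (hxy ▸ hbK.mapsTo hx)
  refine ⟨isHomeomorph_of_dist_homeomorph_le (f.trans f) hGcont hGbij hdist_all, hGimS, hGimK, ?_⟩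
  refine Set.Subset.antisymm ?_ (Set.subset_iInter fun k => ?_)
  · rw [hKdef]
    refine Set.iInter_mono fun k => ?_
    change G^[k] '' P ⊆ S k
    induction k with
    | zero => simp [hSdef]
    | succ k ih =>
      rw [Function.iterate_succ', Set.image_comp]
      exact (Set.image_mono ih).trans (hGimS k)
  · have hiter : G^[k] '' K = K := by
      induction k with
      | zero => simp
      | succ k ih => rw [Function.iterate_succ', Set.image_comp, ih, hGimK]
    calc K = G^[k] '' K := hiter.symm
      _ ⊆ G^[k] '' P := Set.image_mono (hS0 ▸ hKS 0)
end
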